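/- arXiv:2409.19002 — 2 statements merged into one kernel-verified Lean document; each statement's English description precedes it below -/
import Mathlib

section
/- Let f : ℝⁿ → ℂ be bounded and differentiable with all first partial derivatives vanishing at infinity, and let b ∈ C_c(ℝⁿ) be a continuous compactly supported function. Then the integral operator on L²(ℝⁿ) with kernel k(ξ,η) = b(ξ−η)(f(ξ)−f(η)) is compact. -/
open MeasureTheory Filter
open scoped ENNReal

/-- The operator `φ ↦ (x ↦ G x φ)` attached to a `p`-integrable family of functionals is compact. -/
theorem isCompactOperator_compLpL₂_apply_flip {α 𝕜 H : Type*} [MeasurableSpace α] {μ : Measure α}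
    [RCLike 𝕜] [NormedAddCommGroup H] [NormedSpace 𝕜 H] {p : ℝ≥0∞} [Fact (1 ≤ p)] (hp : p ≠ ∞)
    (G : Lp (H →L[𝕜] 𝕜) p μ) :
    IsCompactOperator
      ((ContinuousLinearMap.compLpL₂ p μ (ContinuousLinearMap.apply 𝕜 𝕜)).flip G :
        H →L[𝕜] Lp 𝕜 p μ) := by
  induction G using Lp.induction hp with
  | @indicatorConst c s hs hμs =>
    have h : ((ContinuousLinearMap.compLpL₂ p μ (ContinuousLinearMap.apply 𝕜 𝕜)).flip
        (Lp.simpleFunc.indicatorConst p hs hμs.ne c : Lp (H →L[𝕜] 𝕜) p μ) : H →L[𝕜] Lp 𝕜 p μ) =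
        (ContinuousLinearMap.toSpanSingleton 𝕜 (indicatorConstLp p hs hμs.ne (1 : 𝕜))).comp c := by
      ext φ : 1
      ext1
      simp only [ContinuousLinearMap.flip_apply, ContinuousLinearMap.compLpL₂_apply_apply,
        Lp.simpleFunc.coe_indicatorConst, ContinuousLinearMap.comp_apply,
        ContinuousLinearMap.toSpanSingleton_apply]
      filter_upwards [(ContinuousLinearMap.apply 𝕜 𝕜 φ).coeFn_compLp
          (indicatorConstLp p hs hμs.ne c), indicatorConstLp_coeFn (hs := hs) (hμs := hμs.ne)
          (c := c) (p := p), indicatorConstLp_coeFn (hs := hs) (hμs := hμs.ne)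
          (c := (1 : 𝕜)) (p := p),
          Lp.coeFn_smul (c φ) (indicatorConstLp p hs hμs.ne (1 : 𝕜))] with x h1 h2 h3 h4
      rw [h1, h2, h4, Pi.smul_apply, h3]
      by_cases hx : x ∈ s <;> simp [hx, Set.indicator]
    rw [h]
    exact (isCompactOperator_of_locallyCompactSpace_dom c).clm_comp
      (ContinuousLinearMap.toSpanSingleton 𝕜 (indicatorConstLp p hs hμs.ne (1 : 𝕜)))
  | add hf hg _ ihf ihg =>
    rw [map_add]
    exact ihf.add ihg
  | isClosed =>
    exact IsClosed.preimage
      (ContinuousLinearMap.compLpL₂ p μ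
        (ContinuousLinearMap.apply 𝕜 𝕜 : H →L[𝕜] (H →L[𝕜] 𝕜) →L[𝕜] 𝕜)).flip.continuous
      (isClosed_setOfPred_isCompactOperator (σ₁₂ := RingHom.id 𝕜))

theorem continuous_toLp_of_hasCompactSupport {X Y E : Type*} [PseudoMetricSpace X]
    [PseudoMetricSpace Y] [MeasurableSpace Y] [BorelSpace Y] [T2Space Y] [NormedAddCommGroup E]
    {ν : Measure Y} [IsFiniteMeasureOnCompacts ν] {p : ℝ≥0∞} [Fact (1 ≤ p)] (hp : p ≠ ∞)
    {K : X → Y → E} (hK : Continuous (Function.uncurry K))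
    (hKs : HasCompactSupport (Function.uncurry K)) (hmem : ∀ x, MemLp (K x) p ν) :
    Continuous fun x => (hmem x).toLp (K x) := by
  set s : Set Y := Prod.snd '' tsupport (Function.uncurry K)
  have hsc : IsCompact s := hKs.isCompact.image continuous_snd
  have hsupp (x : X) : Function.support (K x) ⊆ s := fun y hy =>
    ⟨(x, y), subset_tsupport _ hy, rfl⟩
  have huc := hKs.uniformContinuous_of_continuous hK
  rw [Metric.uniformContinuous_iff] at huc
  rw [Metric.continuous_iff]
  intro x ε hε
  have hνs : ν s ^ (1 / p.toReal) ≠ ∞ :=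
    ENNReal.rpow_ne_top_of_nonneg (by positivity) hsc.measure_lt_top.ne
  set m : ℝ := (ν s ^ (1 / p.toReal)).toReal
  have hm0 : 0 ≤ m := ENNReal.toReal_nonneg
  obtain ⟨δ, hδ, h⟩ := huc (ε / (m + 1)) (by positivity)
  refine ⟨δ, hδ, fun x' hx' => ?_⟩
  have hle := eLpNorm_sub_le_of_dist_bdd ν hp hsc.measurableSet (c := ε / (m + 1)) (by positivity)
    (f := K x') (g := K x) (fun y => (h (a := (x', y)) (b := (x, y)) (by simpa using hx')).le)
    (hsupp x') (hsupp x)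
  rw [dist_edist, Lp.edist_toLp_toLp]
  calc (eLpNorm (K x' - K x) p ν).toReal
      ≤ (ENNReal.ofReal (ε / (m + 1)) * ν s ^ (1 / p.toReal)).toReal :=
        ENNReal.toReal_mono (ENNReal.mul_ne_top ENNReal.ofReal_ne_top hνs) hle
    _ = ε / (m + 1) * m := by
        rw [ENNReal.toReal_mul, ENNReal.toReal_ofReal (by positivity)]
    _ < ε := by
        rw [div_mul_eq_mul_div, div_lt_iff₀ (by positivity)]
        nlinarith

theorem lintegral_mul_sq_le {α : Type*} [MeasurableSpace α] {μ : Measure α} {k g : α → ℝ≥0∞}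
    (hk : AEMeasurable k μ) (hg : AEMeasurable g μ) :
    (∫⁻ x, k x * g x ∂μ) ^ 2 ≤ (∫⁻ x, k x ∂μ) * ∫⁻ x, k x * g x ^ 2 ∂μ := by
  have h := ENNReal.lintegral_mul_norm_pow_le hk (hk.mul (hg.pow_const 2))
    (p := 1 / 2) (q := 1 / 2) (by norm_num) (by norm_num) (by norm_num)
  have h2 : ∀ x, k x ^ (1 / 2 : ℝ) * (k x * g x ^ 2) ^ (1 / 2 : ℝ) = k x * g x := by
    intro x
    rw [← ENNReal.mul_rpow_of_nonneg _ _ (by norm_num),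
      show k x * (k x * g x ^ 2) = (k x * g x) ^ (2 : ℝ) by rw [ENNReal.rpow_two]; ring,
      ← ENNReal.rpow_mul]
    norm_num
  simp only [Pi.mul_apply, h2] at h
  rw [← ENNReal.mul_rpow_of_nonneg _ _ (by norm_num)] at h
  calc _ ≤ _ := pow_le_pow_left₀ zero_le h 2
    _ = _ := by
      rw [← ENNReal.rpow_two, ← ENNReal.rpow_mul]
      norm_num

/-- Schur's test. -/
theorem exists_integralOperator_of_schur {X Y 𝕜 : Type*} [RCLike 𝕜] [MeasurableSpace X]
    [MeasurableSpace Y] {μ : Measure X} {ν : Measure Y} [SFinite μ] [SFinite ν] {K : X → Y → 𝕜}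
    (hK : Measurable (Function.uncurry K)) {C : ℝ} (hC : 0 ≤ C)
    (h₁ : ∀ x, ∫⁻ y, ‖K x y‖ₑ ∂ν ≤ ENNReal.ofReal C)
    (h₂ : ∀ y, ∫⁻ x, ‖K x y‖ₑ ∂μ ≤ ENNReal.ofReal C) :
    ∃ T : Lp 𝕜 2 ν →L[𝕜] Lp 𝕜 2 μ, ‖T‖ ≤ C ∧
      ∀ φ : Lp 𝕜 2 ν, ∀ᵐ x ∂μ, T φ x = ∫ y, K x y * φ y ∂ν := by
  have hKφ (φ : Lp 𝕜 2 ν) : StronglyMeasurable fun q : X × Y => K q.1 q.2 * φ q.2 :=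
    hK.stronglyMeasurable.mul ((Lp.stronglyMeasurable φ).comp_measurable measurable_snd)
  have hKe : Measurable fun q : X × Y => ‖K q.1 q.2‖ₑ := hK.enorm
  have hsq (φ : Lp 𝕜 2 ν) : ∫⁻ y, ‖φ y‖ₑ ^ 2 ∂ν = eLpNorm φ 2 ν ^ 2 := by
    simpa using (eLpNorm_nnreal_pow_eq_lintegral (f := φ) (μ := ν) (p := 2) (by simp)).symm
  have hbound (φ : Lp 𝕜 2 ν) : ∫⁻ x, (∫⁻ y, ‖K x y * φ y‖ₑ ∂ν) ^ 2 ∂μ ≤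
      (ENNReal.ofReal C * eLpNorm φ 2 ν) ^ 2 := by
    have hφ : Measurable fun y => ‖φ y‖ₑ := (Lp.stronglyMeasurable φ).measurable.enorm
    calc ∫⁻ x, (∫⁻ y, ‖K x y * φ y‖ₑ ∂ν) ^ 2 ∂μ
        ≤ ∫⁻ x, ENNReal.ofReal C * ∫⁻ y, ‖K x y‖ₑ * ‖φ y‖ₑ ^ 2 ∂ν ∂μ := by
          refine lintegral_mono fun x => ?_
          simp only [enorm_mul]
          exact (lintegral_mul_sq_le (hKe.comp measurable_prodMk_left).aemeasurable
            hφ.aemeasurable).trans (mul_le_mul_left (h₁ x) _)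
      _ = ENNReal.ofReal C * ∫⁻ y, (∫⁻ x, ‖K x y‖ₑ ∂μ) * ‖φ y‖ₑ ^ 2 ∂ν := by
          have hm : Measurable fun q : X × Y => ‖K q.1 q.2‖ₑ * ‖φ q.2‖ₑ ^ 2 :=
            hKe.mul ((hφ.comp measurable_snd).pow_const 2)
          rw [lintegral_const_mul _ hm.lintegral_prod_right',
            lintegral_lintegral_swap hm.aemeasurable]
          congr 1
          refine lintegral_congr fun y => ?_
          exact lintegral_mul_const (‖φ y‖ₑ ^ 2) (hKe.comp (measurable_prodMk_right (y := y)))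
      _ ≤ ENNReal.ofReal C * ∫⁻ y, ENNReal.ofReal C * ‖φ y‖ₑ ^ 2 ∂ν := by
          gcongr with y
          exact h₂ y
      _ = (ENNReal.ofReal C * eLpNorm φ 2 ν) ^ 2 := by
          rw [lintegral_const_mul _ (hφ.pow_const 2), hsq]
          ring
  have hint (φ : Lp 𝕜 2 ν) : ∀ᵐ x ∂μ, Integrable (fun y => K x y * φ y) ν := by
    have hfin : ∫⁻ x, (∫⁻ y, ‖K x y * φ y‖ₑ ∂ν) ^ 2 ∂μ ≠ ∞ :=
      ne_top_of_le_ne_top (ENNReal.pow_ne_top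
        (ENNReal.mul_ne_top ENNReal.ofReal_ne_top (Lp.eLpNorm_ne_top φ))) (hbound φ)
    filter_upwards [ae_lt_top ((hKφ φ).measurable.enorm.lintegral_prod_right'.pow_const 2) hfin]
      with x hx
    refine ⟨((hKφ φ).comp_measurable measurable_prodMk_left).aestronglyMeasurable, ?_⟩
    simpa [HasFiniteIntegral] using hx
  have hnorm (φ : Lp 𝕜 2 ν) : eLpNorm (fun x => ∫ y, K x y * φ y ∂ν) 2 μ ≤
      ENNReal.ofReal C * eLpNorm φ 2 ν := by
    rw [← ENNReal.pow_le_pow_left_iff two_ne_zero]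
    calc eLpNorm (fun x => ∫ y, K x y * φ y ∂ν) 2 μ ^ 2
        = ∫⁻ x, ‖∫ y, K x y * φ y ∂ν‖ₑ ^ 2 ∂μ := by
          simpa using eLpNorm_nnreal_pow_eq_lintegral (f := fun x => ∫ y, K x y * φ y ∂ν) (μ := μ)
            (p := 2) (by simp)
      _ ≤ ∫⁻ x, (∫⁻ y, ‖K x y * φ y‖ₑ ∂ν) ^ 2 ∂μ := by
          gcongr with x
          exact enorm_integral_le_lintegral_enorm _
      _ ≤ _ := hbound φ
  have hmem (φ : Lp 𝕜 2 ν) : MemLp (fun x => ∫ y, K x y * φ y ∂ν) 2 μ :=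
    ⟨(hKφ φ).integral_prod_right'.aestronglyMeasurable, (hnorm φ).trans_lt
      (ENNReal.mul_lt_top ENNReal.ofReal_lt_top (Lp.eLpNorm_lt_top φ))⟩
  let L : Lp 𝕜 2 ν →ₗ[𝕜] Lp 𝕜 2 μ :=
    { toFun := fun φ => (hmem φ).toLp _
      map_add' := fun φ ψ => by
        rw [← MemLp.toLp_add, MemLp.toLp_eq_toLp_iff]
        filter_upwards [hint φ, hint ψ] with x hφ hψ
        rw [Pi.add_apply, ← integral_add hφ hψ]
        refine integral_congr_ae ?_
        filter_upwards [Lp.coeFn_add φ ψ] with y hy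
        rw [hy, Pi.add_apply, mul_add]
      map_smul' := fun c φ => by
        rw [RingHom.id_apply, ← MemLp.toLp_const_smul, MemLp.toLp_eq_toLp_iff]
        refine .of_forall fun x => ?_
        rw [Pi.smul_apply, ← integral_smul]
        refine integral_congr_ae ?_
        filter_upwards [Lp.coeFn_smul c φ] with y hy
        rw [hy, Pi.smul_apply, smul_eq_mul, smul_eq_mul, mul_left_comm] }
  refine ⟨L.mkContinuous C fun φ => ?_, L.mkContinuous_norm_le hC _, fun φ => (hmem φ).coeFn_toLp⟩
  change ‖(hmem φ).toLp _‖ ≤ _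
  rw [Lp.norm_toLp, Lp.norm_def, ← ENNReal.toReal_ofReal hC, ← ENNReal.toReal_mul]
  exact ENNReal.toReal_mono
    (ENNReal.mul_ne_top ENNReal.ofReal_ne_top (Lp.eLpNorm_ne_top φ)) (hnorm φ)

/-- A continuous compactly supported kernel defines a compact integral operator on `L²`. -/
theorem exists_isCompactOperator_integralOperator {X Y 𝕜 : Type*} [RCLike 𝕜]
    [MetricSpace X] [MeasurableSpace X] [BorelSpace X]
    [MetricSpace Y] [MeasurableSpace Y] [BorelSpace Y]
    {μ : Measure X} {ν : Measure Y} [IsFiniteMeasureOnCompacts μ] [IsFiniteMeasureOnCompacts ν]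
    {K : X → Y → 𝕜} (hK : Continuous (Function.uncurry K))
    (hKs : HasCompactSupport (Function.uncurry K)) :
    ∃ T : Lp 𝕜 2 ν →L[𝕜] Lp 𝕜 2 μ, IsCompactOperator T ∧
      ∀ φ : Lp 𝕜 2 ν, ∀ᵐ x ∂μ, T φ x = ∫ y, K x y * φ y ∂ν := by
  set K' : X → Y → 𝕜 := fun x y => star (K x y) with hK'
  have hcont : Continuous (Function.uncurry K') := continuous_star.comp hK
  have hsupp : HasCompactSupport (Function.uncurry K') := hKs.comp_left (star_zero 𝕜)
  have hz (x : X) (hx : x ∉ Prod.fst '' tsupport (Function.uncurry K')) (y : Y) : K' x y = 0 := by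
    by_contra h
    exact hx ⟨(x, y), subset_tsupport _ h, rfl⟩
  have hmem (x : X) : MemLp (K' x) 2 ν := by
    refine (hcont.comp (Continuous.prodMk_right x)).memLp_of_hasCompactSupport
      (HasCompactSupport.intro (hsupp.isCompact.image continuous_snd) fun y hy => ?_)
    by_contra h
    exact hy ⟨(x, y), subset_tsupport _ h, rfl⟩
  set G : X → (Lp 𝕜 2 ν →L[𝕜] 𝕜) := fun x => innerSL 𝕜 ((hmem x).toLp (K' x)) with hG
  have hGc : Continuous G := (innerSL 𝕜).continuous.comp
    (continuous_toLp_of_hasCompactSupport ENNReal.ofNat_ne_top hcont hsupp hmem)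
  have hGs : HasCompactSupport G := by
    refine HasCompactSupport.intro (hsupp.isCompact.image continuous_fst) fun x hx => ?_
    have : (hmem x).toLp (K' x) = 0 := by
      rw [Lp.eq_zero_iff_ae_eq_zero]
      exact (hmem x).coeFn_toLp.trans (.of_forall (hz x hx))
    simp [hG, this]
  have hGm : MemLp G 2 μ := hGc.memLp_of_hasCompactSupport hGs
  refine ⟨_, isCompactOperator_compLpL₂_apply_flip ENNReal.ofNat_ne_top (hGm.toLp G), fun φ => ?_⟩
  filter_upwards [(ContinuousLinearMap.apply 𝕜 𝕜 φ).coeFn_compLp (hGm.toLp G), hGm.coeFn_toLp]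
    with x h1 h2
  rw [ContinuousLinearMap.flip_apply, ContinuousLinearMap.compLpL₂_apply_apply, h1, h2,
    ContinuousLinearMap.apply_apply, hG, innerSL_apply_apply, L2.inner_def]
  refine integral_congr_ae ?_
  filter_upwards [(hmem x).coeFn_toLp] with y hy
  rw [hy, RCLike.inner_apply, hK']
  simp [mul_comm]

theorem exists_integralOperator_of_norm_le_mul_norm_sub {E 𝕜 : Type*} [RCLike 𝕜]
    [AddGroup E] [MeasurableSpace E] [MeasurableAdd E] [MeasurableNeg E]
    {μ : Measure E} [SFinite μ] [μ.IsAddLeftInvariant] [μ.IsAddRightInvariant] [μ.IsNegInvariant]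
    {K : E → E → 𝕜} (hK : Measurable (Function.uncurry K)) {b : E → 𝕜} (hb : Integrable b μ)
    {c : ℝ} (hc : 0 ≤ c) (hKb : ∀ x y, ‖K x y‖ ≤ c * ‖b (x - y)‖) :
    ∃ T : Lp 𝕜 2 μ →L[𝕜] Lp 𝕜 2 μ, ‖T‖ ≤ c * ∫ x, ‖b x‖ ∂μ ∧
      ∀ φ : Lp 𝕜 2 μ, ∀ᵐ x ∂μ, T φ x = ∫ y, K x y * φ y ∂μ := by
  have hKe (x y : E) : ‖K x y‖ₑ ≤ ENNReal.ofReal c * ‖b (x - y)‖ₑ := by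
    rw [← ofReal_norm, ← ofReal_norm, ← ENNReal.ofReal_mul hc]
    exact ENNReal.ofReal_le_ofReal (hKb x y)
  have hbi : ENNReal.ofReal (c * ∫ x, ‖b x‖ ∂μ) = ENNReal.ofReal c * ∫⁻ x, ‖b x‖ₑ ∂μ := by
    rw [ENNReal.ofReal_mul hc, ofReal_integral_norm_eq_lintegral_enorm hb]
  refine exists_integralOperator_of_schur hK (by positivity) (fun x => ?_) (fun y => ?_)
  · rw [hbi, ← lintegral_sub_left_eq_self (fun z => ‖b z‖ₑ) x,
      ← lintegral_const_mul' _ _ ENNReal.ofReal_ne_top]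
    exact lintegral_mono (hKe x)
  · rw [hbi, ← lintegral_sub_right_eq_self (fun z => ‖b z‖ₑ) y,
      ← lintegral_const_mul' _ _ ENNReal.ofReal_ne_top]
    exact lintegral_mono fun x => hKe x y

theorem exists_isCompact_norm_sub_le_of_tendsto_fderiv {E F : Type*} [NormedAddCommGroup E]
    [NormedSpace ℝ E] [ProperSpace E] [NormedAddCommGroup F] [NormedSpace ℝ F] {f : E → F}
    (hf : Differentiable ℝ f)
    (hf' : Tendsto (fun x => ‖fderiv ℝ f x‖) (cocompact E) (nhds 0)) {R ε : ℝ}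
    (hR : 0 ≤ R) (hε : 0 < ε) :
    ∃ s : Set E, IsCompact s ∧ ∀ x ∉ s, ∀ y, ‖x - y‖ ≤ R → ‖f x - f y‖ ≤ ε := by
  obtain ⟨t, ht, htε⟩ := mem_cocompact.mp
    (hf'.eventually (gt_mem_nhds (show 0 < ε / (R + 1) by positivity)))
  refine ⟨Metric.cthickening R t, ht.cthickening, fun x hx y hxy => ?_⟩
  have hbd : ∀ z ∈ Metric.closedBall x R, ‖fderiv ℝ f z‖ ≤ ε / (R + 1) := fun z hz =>
    (htε fun hzt => hx (Metric.mem_cthickening_of_dist_le x z R t hzt (by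
      rwa [dist_comm, ← Metric.mem_closedBall]))).le
  have hmv := (convex_closedBall x R).norm_image_sub_le_of_norm_fderiv_le
    (fun z _ => hf z) hbd (x := y) (y := x)
    (by rwa [Metric.mem_closedBall, dist_comm, dist_eq_norm]) (Metric.mem_closedBall_self hR)
  calc ‖f x - f y‖ ≤ ε / (R + 1) * ‖x - y‖ := hmv
    _ ≤ ε / (R + 1) * (R + 1) := by gcongr; linarith
    _ = ε := by field_simp

/-- The commutator of convolution by `b` with multiplication by `f` is compact on `L²`. -/
theorem exists_isCompactOperator_commutator {E : Type*} [NormedAddCommGroup E] [NormedSpace ℝ E]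
    [FiniteDimensional ℝ E] [MeasurableSpace E] [BorelSpace E] {μ : Measure E} [μ.IsAddHaarMeasure]
    {f b : E → ℂ} (hbdd : ∃ M, ∀ ξ, ‖f ξ‖ ≤ M) (hdiff : Differentiable ℝ f)
    (hvanish : Tendsto (fun ξ => ‖fderiv ℝ f ξ‖) (cocompact E) (nhds 0))
    (hb : Continuous b) (hbsupp : HasCompactSupport b) :
    ∃ T : Lp ℂ 2 μ →L[ℂ] Lp ℂ 2 μ, IsCompactOperator T ∧
      ∀ φ : Lp ℂ 2 μ, ∀ᵐ ξ ∂μ, T φ ξ = ∫ η, b (ξ - η) * (f ξ - f η) * φ η ∂μ := by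
  have : ProperSpace E := FiniteDimensional.proper ℝ E
  obtain ⟨M, hM⟩ := hbdd
  have hM0 : 0 ≤ M := (norm_nonneg _).trans (hM 0)
  have hf : Continuous f := hdiff.continuous
  have hbi : Integrable b μ := hb.integrable_of_hasCompactSupport hbsupp
  set k : E → E → ℂ := fun ξ η => b (ξ - η) * (f ξ - f η)
  have hk : Continuous (Function.uncurry k) := by
    change Continuous fun q : E × E => b (q.1 - q.2) * (f q.1 - f q.2)
    fun_prop
  obtain ⟨T, -, hT⟩ := exists_integralOperator_of_norm_le_mul_norm_sub hk.measurable hbi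
    (c := M + M) (by positivity) fun ξ η => by
      rw [norm_mul, mul_comm]
      gcongr
      exact (norm_sub_le _ _).trans (add_le_add (hM ξ) (hM η))
  refine ⟨T, ?_, hT⟩
  suffices T ∈ closure {S : Lp ℂ 2 μ →L[ℂ] Lp ℂ 2 μ |
      IsCompactOperator S} by
    rwa [isClosed_setOfPred_isCompactOperator.closure_eq] at this
  rw [Metric.mem_closure_iff]
  intro ε hε
  obtain ⟨R, hR⟩ := hbsupp.isCompact.isBounded.exists_norm_le
  set B : ℝ := ∫ ξ, ‖b ξ‖ ∂μ
  have hB : 0 ≤ B := integral_nonneg fun ξ => norm_nonneg _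
  obtain ⟨s, hs, hsf⟩ := exists_isCompact_norm_sub_le_of_tendsto_fderiv hdiff hvanish
    (R := max R 0) (ε := ε / (B + 1)) (le_max_right _ _) (by positivity)
  obtain ⟨χ, hχ1, -, hχs, hχ⟩ := exists_continuous_one_zero_of_isCompact hs isClosed_empty
    (Set.disjoint_empty s)
  obtain ⟨T₁, hT₁c, hT₁⟩ := exists_isCompactOperator_integralOperator
    (μ := μ) (ν := μ) (K := fun ξ η => (χ ξ : ℂ) * k ξ η)
    ((Complex.continuous_ofReal.comp (χ.continuous.comp continuous_fst)).mul hk) (by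
      refine HasCompactSupport.intro ((hχs.isCompact.prod hbsupp.isCompact).image
        (f := fun q : E × E => (q.1, q.1 - q.2)) (by fun_prop)) fun q hq => ?_
      by_contra h
      simp only [Function.uncurry, k, mul_eq_zero, not_or, Complex.ofReal_eq_zero] at h
      exact hq ⟨(q.1, q.1 - q.2), ⟨subset_tsupport _ h.1, subset_tsupport _ h.2.1⟩, by simp⟩)
  obtain ⟨T₂, hT₂n, hT₂⟩ := exists_integralOperator_of_norm_le_mul_norm_sub
    (K := fun ξ η => ((1 - χ ξ : ℝ) : ℂ) * k ξ η)
    (((Complex.continuous_ofReal.comp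
      (continuous_const.sub (χ.continuous.comp continuous_fst))).mul hk).measurable) hbi
    (c := ε / (B + 1)) (by positivity) fun ξ η => by
      by_cases hξ : ξ ∈ s
      · simp only [hχ1 hξ, Pi.one_apply, sub_self, Complex.ofReal_zero, zero_mul, norm_zero]
        positivity
      by_cases hξη : ξ - η ∈ tsupport b
      · rw [norm_mul, norm_mul, Complex.norm_real, Real.norm_of_nonneg (by linarith [(hχ ξ).2]),
          mul_comm ‖b _‖]
        refine (mul_le_of_le_one_left (by positivity) (by linarith [(hχ ξ).1])).trans ?_
        gcongr
        exact hsf ξ hξ η ((hR _ hξη).trans (le_max_left _ _))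
      · simp [k, image_eq_zero_of_notMem_tsupport hξη]
  refine ⟨T₁, hT₁c, ?_⟩
  have hsub : T - T₁ = T₂ := by
    ext φ : 1
    ext1
    rw [sub_apply]
    filter_upwards [Lp.coeFn_sub (T φ) (T₁ φ), hT φ, hT₁ φ, hT₂ φ] with ξ h h0 h1 h2
    rw [h, Pi.sub_apply, h0, h1, h2]
    simp only [mul_assoc _ (k ξ _), integral_const_mul]
    push_cast
    ring
  rw [dist_eq_norm, hsub]
  refine hT₂n.trans_lt ?_
  rw [div_mul_eq_mul_div, div_lt_iff₀ (by positivity)]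
  nlinarith

/-- The commutator kernel `k(ξ,η) = b(ξ−η)(f(ξ)−f(η))`, with `f` bounded
differentiable with derivative vanishing at infinity and `b` continuous with
compact support, defines a compact integral operator on `L²(ℝⁿ)`. -/
theorem stmt6 {n : ℕ} (f b : EuclideanSpace ℝ (Fin n) → ℂ)
    (hbdd : ∃ M, ∀ ξ, ‖f ξ‖ ≤ M)
    (hdiff : Differentiable ℝ f)
    (hvanish : Tendsto (fun ξ => ‖fderiv ℝ f ξ‖)
      (cocompact (EuclideanSpace ℝ (Fin n))) (nhds 0))
    (hb : Continuous b) (hbsupp : HasCompactSupport b) :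
    ∃ T : Lp ℂ 2 (volume : Measure (EuclideanSpace ℝ (Fin n))) →L[ℂ]
        Lp ℂ 2 (volume : Measure (EuclideanSpace ℝ (Fin n))),
      IsCompactOperator T ∧
      ∀ φ : Lp ℂ 2 (volume : Measure (EuclideanSpace ℝ (Fin n))),
        ∀ᵐ ξ, (T φ : EuclideanSpace ℝ (Fin n) → ℂ) ξ
          = ∫ η, b (ξ - η) * (f ξ - f η) * (φ : EuclideanSpace ℝ (Fin n) → ℂ) η :=
  exists_isCompactOperator_commutator hbdd hdiff hvanish hb hbsupp
end

section
/- Let D be a self-adjoint operator on a Hilbert space H. Then for every vector h in the domain of D, (2/π) ∫₀^∞ D(D² + λ² + 1)⁻¹ h dλ = D(D²+1)^{-1/2} h, i.e. the bounded transform D(D²+1)^{-1/2} has the integral representation (2/π)∫₀^∞ D(D²+λ²+1)⁻¹ dλ. -/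
open MeasureTheory ContinuousLinearMap
open scoped InnerProductSpace

lemma integral_Ici_sq_div_one_add_sq_mul_sq {q : ℝ} (hq : 0 ≤ q) :
    ∫ l in Set.Ici (0 : ℝ), q ^ 2 / (1 + l ^ 2 * q ^ 2) = Real.pi / 2 * q := by
  rcases hq.eq_or_lt with rfl | hq
  · simp
  have h := integral_comp_mul_left_Ioi (fun u : ℝ => (1 + u ^ 2)⁻¹) 0 hq
  rw [mul_zero, integral_Ioi_inv_one_add_sq, Real.arctan_zero, sub_zero, smul_eq_mul] at h
  have hfun : (fun l : ℝ => q ^ 2 / (1 + l ^ 2 * q ^ 2)) =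
      fun l => q ^ 2 * (1 + (q * l) ^ 2)⁻¹ := by
    ext l
    rw [div_eq_mul_inv, mul_pow, mul_comm (l ^ 2)]
  rw [integral_Ici_eq_integral_Ioi, hfun, integral_const_mul, h]
  field_simp

lemma continuous_uncurry_sq_div_one_add_sq_mul_sq :
    Continuous (Function.uncurry fun l q : ℝ => q ^ 2 / (1 + l ^ 2 * q ^ 2)) := by
  refine Continuous.div (by fun_prop) (by fun_prop) fun p => ?_
  positivity

section CStarAlgebra

variable {A : Type*} [CStarAlgebra A]

/-- The functions `q ↦ q² / (1 + l² q²)` are dominated, uniformly in `q` on the spectrum of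
any element, by an integrable function of `l`. -/
lemma exists_integrable_bound_sq_div_one_add_sq_mul_sq (a : A) :
    ∃ bound : ℝ → ℝ, Integrable bound ∧
      ∀ l : ℝ, ∀ q ∈ spectrum ℝ a, ‖q ^ 2 / (1 + l ^ 2 * q ^ 2)‖ ≤ bound l := by
  set M : ℝ := ‖a‖ * ‖(1 : A)‖ + 1
  have hM : 0 < M := by positivity
  refine ⟨fun l => M ^ 2 * (1 + (M * l) ^ 2)⁻¹,
    (integrable_inv_one_add_sq.comp_mul_left' hM.ne').const_mul _, fun l q hq => ?_⟩
  have hqM : ‖q‖ ≤ M := (spectrum.norm_le_norm_mul_of_mem hq).trans (by simp [M])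
  have hsq : q ^ 2 ≤ M ^ 2 := sq_le_sq' (abs_le.mp hqM).1 (abs_le.mp hqM).2
  beta_reduce
  rw [Real.norm_of_nonneg (by positivity), ← div_eq_mul_inv,
    div_le_div_iff₀ (by positivity) (by positivity)]
  nlinarith

lemma eq_cfc_sq_div_one_add_sq_mul_sq {a b : A} (ha : IsSelfAdjoint a) (l : ℝ)
    (hb : b + l ^ 2 • (a * a * b) = a * a) :
    b = cfc (fun q : ℝ => q ^ 2 / (1 + l ^ 2 * q ^ 2)) a := by
  have hne (q : ℝ) : 1 + l ^ 2 * q ^ 2 ≠ 0 := by positivity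
  have hcont : Continuous fun q : ℝ => (1 + l ^ 2 * q ^ 2)⁻¹ :=
    Continuous.inv₀ (by fun_prop) hne
  have hden : cfc (fun q : ℝ => 1 + l ^ 2 * q ^ 2) a = 1 + l ^ 2 • (a * a) := by
    rw [cfc_const_add (1 : ℝ) (fun q : ℝ => l ^ 2 * q ^ 2) a,
      cfc_const_mul (l ^ 2) (fun q : ℝ => q ^ 2) a, cfc_pow_id a 2, map_one, pow_two a]
  have hinv : cfc (fun q : ℝ => (1 + l ^ 2 * q ^ 2)⁻¹) a * (1 + l ^ 2 • (a * a)) = 1 := by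
    rw [← hden, ← cfc_mul _ _ a hcont.continuousOn]
    simp_rw [inv_mul_cancel₀ (hne _)]
    exact cfc_const_one ℝ a
  have hfun : (fun q : ℝ => q ^ 2 / (1 + l ^ 2 * q ^ 2)) =
      fun q => (1 + l ^ 2 * q ^ 2)⁻¹ * q ^ 2 := by
    ext q
    rw [div_eq_inv_mul]
  rw [hfun, cfc_mul _ _ a hcont.continuousOn, cfc_pow_id a 2, pow_two a, ← hb]
  calc b = cfc (fun q : ℝ => (1 + l ^ 2 * q ^ 2)⁻¹) a * (1 + l ^ 2 • (a * a)) * b := by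
        rw [hinv, one_mul]
    _ = _ := by rw [mul_assoc, add_mul, one_mul, smul_mul_assoc]

variable [PartialOrder A] [StarOrderedRing A]

lemma integrableOn_cfc_sq_div_one_add_sq_mul_sq {a : A} (ha : 0 ≤ a) :
    IntegrableOn (fun l : ℝ => cfc (fun q : ℝ => q ^ 2 / (1 + l ^ 2 * q ^ 2)) a)
      (Set.Ici 0) := by
  obtain ⟨bound, hint, hle⟩ := exists_integrable_bound_sq_div_one_add_sq_mul_sq a
  exact integrableOn_cfc measurableSet_Ici _ bound a
    continuous_uncurry_sq_div_one_add_sq_mul_sq.continuousOn (.of_forall hle)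
    hint.integrableOn.hasFiniteIntegral

lemma integral_cfc_sq_div_one_add_sq_mul_sq {a : A} (ha : 0 ≤ a) :
    ∫ l in Set.Ici (0 : ℝ), cfc (fun q : ℝ => q ^ 2 / (1 + l ^ 2 * q ^ 2)) a =
      (Real.pi / 2) • a := by
  obtain ⟨bound, hint, hle⟩ := exists_integrable_bound_sq_div_one_add_sq_mul_sq a
  rw [← cfc_setIntegral measurableSet_Ici _ bound a
    continuous_uncurry_sq_div_one_add_sq_mul_sq.continuousOn (.of_forall hle)
    hint.integrableOn.hasFiniteIntegral, ← cfc_const_mul_id (Real.pi / 2) a]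
  exact cfc_congr fun q hq =>
    integral_Ici_sq_div_one_add_sq_mul_sq (spectrum_nonneg_of_nonneg ha hq)

end CStarAlgebra

/-- Integral representation of the bounded transform: for a self-adjoint operator
`D` (symmetric with bounded resolvents `R λ = (D²+λ²+1)⁻¹`, `A λ = D R λ`), and
`S = D (D²+1)^{-1/2}` (with `Q = (D²+1)^{-1/2}` the positive square root of
`R 0 = (D²+1)⁻¹` commuting with the resolvents), one has for every `x ∈ dom D`:
`(2/π) ∫₀^∞ D (D²+λ²+1)⁻¹ x dλ = D (D²+1)^{-1/2} x`. -/
theorem stmt18 {H : Type*} [NormedAddCommGroup H] [InnerProductSpace ℂ H] [CompleteSpace H]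
    (dom : Submodule ℂ H) (hdense : Dense (dom : Set H))
    (Dop : dom →ₗ[ℂ] H)
    (hsym : ∀ x y : dom, ⟪Dop x, (y : H)⟫_ℂ = ⟪(x : H), Dop y⟫_ℂ)
    (R : ℝ → (H →L[ℂ] H)) (hRsa : ∀ l : ℝ, IsSelfAdjoint (R l))
    (hR : ∀ (l : ℝ) (y : H), ∃ (h1 : R l y ∈ dom) (h2 : Dop ⟨R l y, h1⟩ ∈ dom),
      Dop ⟨Dop ⟨R l y, h1⟩, h2⟩ + (l ^ 2 + 1) • R l y = y)
    (hRleft : ∀ (l : ℝ) (x : dom) (hx : Dop x ∈ dom),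
      R l (Dop ⟨Dop x, hx⟩ + (l ^ 2 + 1) • (x : H)) = (x : H))
    (A : ℝ → (H →L[ℂ] H)) (hAcont : Continuous A)
    (hA : ∀ (l : ℝ) (y : H), ∃ h : R l y ∈ dom, A l y = Dop ⟨R l y, h⟩)
    -- `Q = (D²+1)^{-1/2}`: the positive square root of `R 0`, commuting with resolvents
    (Q : H →L[ℂ] H) (hQpos : Q.IsPositive)
    (hQsq : Q ∘L Q = R 0)
    (hQcomm : ∀ l : ℝ, Q ∘L R l = R l ∘L Q)
    -- `S = D (D²+1)^{-1/2}` bounded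
    (S : H →L[ℂ] H) (hS : ∀ y : H, ∃ h : Q y ∈ dom, S y = Dop ⟨Q y, h⟩) :
    ∀ x : H, x ∈ dom →
      (∫ l in Set.Ici (0 : ℝ), (2 / Real.pi) • A l x) = S x := by
  intro x hx
  have hQnonneg : 0 ≤ Q := (nonneg_iff_isPositive Q).mpr hQpos
  have hRcfc (l : ℝ) : R l = cfc (fun q : ℝ => q ^ 2 / (1 + l ^ 2 * q ^ 2)) Q := by
    refine eq_cfc_sq_div_one_add_sq_mul_sq hQpos.isSelfAdjoint l ?_
    ext y
    obtain ⟨h1, h2, hy⟩ := hR l y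
    have h := hRleft 0 ⟨R l y, h1⟩ h2
    have hQQ (z : H) : Q (Q z) = R 0 z := by rw [← hQsq]; rfl
    have hz : Dop ⟨Dop ⟨R l y, h1⟩, h2⟩ = y - (l ^ 2 + 1) • R l y := eq_sub_of_add_eq hy
    have hsum : y - (l ^ 2 + 1) • R l y + ((0 : ℝ) ^ 2 + 1) • R l y = y - l ^ 2 • R l y := by
      module
    rw [hz, hsum, map_sub, map_smul_of_tower] at h
    change R l y + l ^ 2 • Q (Q (R l y)) = Q (Q y)
    rw [hQQ, hQQ]
    exact (sub_eq_iff_eq_add.mp h).symm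
  have hRint (y : H) : IntegrableOn (fun l => R l y) (Set.Ici 0) := by
    simp_rw [hRcfc]
    exact (integrableOn_cfc_sq_div_one_add_sq_mul_sq hQnonneg).apply_continuousLinearMap y
  have hRintegral (y : H) : ∫ l in Set.Ici (0 : ℝ), R l y = (Real.pi / 2) • Q y := by
    simp_rw [hRcfc]
    rw [← ContinuousLinearMap.integral_apply
      (integrableOn_cfc_sq_div_one_add_sq_mul_sq hQnonneg) y,
      integral_cfc_sq_div_one_add_sq_mul_sq hQnonneg]
    rfl
  have hAR (l : ℝ) : A l x = R l (Dop ⟨x, hx⟩) := by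
    obtain ⟨h1, h2, hy⟩ := hR l x
    obtain ⟨h1', hAx⟩ := hA l x
    have hz : Dop ⟨Dop ⟨R l x, h1⟩, h2⟩ = x - (l ^ 2 + 1) • R l x := eq_sub_of_add_eq hy
    have hsub : (⟨Dop ⟨Dop ⟨R l x, h1⟩, h2⟩, by
        rw [hz]
        exact dom.sub_mem hx (dom.smul_of_tower_mem _ h1)⟩ : dom) =
          ⟨x, hx⟩ - (l ^ 2 + 1) • ⟨R l x, h1⟩ := Subtype.ext hz
    have h := hRleft l ⟨Dop ⟨R l x, h1⟩, h2⟩ (by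
      rw [hz]
      exact dom.sub_mem hx (dom.smul_of_tower_mem _ h1))
    rw [hsub, map_sub, LinearMap.map_smul_of_tower, sub_add_cancel] at h
    rw [hAx, h]
  have hAint : IntegrableOn (fun l => A l x) (Set.Ici 0) := by
    simp_rw [hAR]
    exact hRint _
  rw [integral_smul]
  refine hdense.eq_of_inner_right (𝕜 := ℂ) fun z hz => ?_
  have hinner (l : ℝ) : ⟪z, A l x⟫_ℂ = ⟪Dop ⟨z, hz⟩, R l x⟫_ℂ := by
    obtain ⟨h, hAx⟩ := hA l x
    rw [hAx]
    exact (hsym ⟨z, hz⟩ ⟨R l x, h⟩).symm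
  obtain ⟨hQx, hSx⟩ := hS x
  rw [inner_smul_right_eq_smul, ← integral_inner hAint]
  simp_rw [hinner]
  rw [integral_inner (hRint x), hRintegral, inner_smul_right_eq_smul, smul_smul, hSx,
    ← hsym ⟨z, hz⟩ ⟨Q x, hQx⟩, div_mul_div_comm, mul_comm 2, div_self (by positivity), one_smul]
end
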